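/- Let F_2 = ⟨a, b⟩ and let ℓ = ℓ(⟨b⟩, ⟨b^a⟩). For k ∈ ℤ, the line ℓ(⟨b⟩, ⟨b^{a b^k}⟩) is a neighbor of ℓ if and only if k ∈ {1, -1}, where a parallel line ℓ' is a neighbor of ℓ if every vertex of ℓ has an E-neighbor on ℓ'. -/

import Mathlib

open Subgroup

abbrev F2 := FreeGroup (Fin 2)

def ga : F2 := FreeGroup.of 0
def gb : F2 := FreeGroup.of 1

def IsBasis (x y : F2) : Prop :=
  Function.Bijective (FreeGroup.lift ![x, y] : FreeGroup (Fin 2) →* F2)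

/-- Adjacency of vertices of `AF₂`. -/
def Eadj (S T : Subgroup F2) : Prop :=
  ∃ u v : F2, S = zpowers u ∧ T = zpowers v ∧ IsBasis u v

def D1 (S : Subgroup F2) : Set (Subgroup F2) := {T | Eadj S T}

/-- The line of a 1-conjugate pair: the set of common neighbors. -/
def line (S T : Subgroup F2) : Set (Subgroup F2) := D1 S ∩ D1 T

section Helpers

open FreeGroup hiding map_mul map_inv map_one norm_eq_zero norm_one

def HeadIn (i : Fin 2) (x : F2) : Prop := ∀ p ∈ x.toWord.head?, p.1 = i

def LastIn (i : Fin 2) (x : F2) : Prop := ∀ p ∈ x.toWord.getLast?, p.1 = i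

lemma lastIn_inv {i : Fin 2} {x : F2} : LastIn i x⁻¹ ↔ HeadIn i x := by
  unfold LastIn HeadIn
  rw [toWord_inv]
  cases h : x.toWord with
  | nil => simp [invRev]
  | cons p L => simp [invRev]

lemma headIn_inv {i : Fin 2} {x : F2} : HeadIn i x⁻¹ ↔ LastIn i x := by
  rw [← lastIn_inv, inv_inv]

lemma toWord_mul_of {i j : Fin 2} (hij : i ≠ j) {x y : F2} (hx : LastIn i x) (hy : HeadIn j y) :
    (x * y).toWord = x.toWord ++ y.toWord := by
  rw [toWord_mul]
  apply IsReduced.reduce_eq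
  unfold FreeGroup.IsReduced
  rw [List.isChain_append]
  refine ⟨isReduced_toWord, isReduced_toWord, ?_⟩
  intro p hp q hq h
  exact absurd ((hx p hp).symm.trans (h.trans (hy q hq))) hij

lemma headIn_pow {i : Fin 2} {x : F2} (hx : HeadIn i x) (n : ℕ) :
    HeadIn i (x ^ n) ∧ (n ≠ 0 → x.norm ≤ (x ^ n).norm) := by
  rcases n with _ | n
  · simp [HeadIn]
  have h1 : (x ^ (n + 1)).toWord = reduceCyclically.conjugator x.toWord ++
      (List.replicate (n + 1) (reduceCyclically x.toWord)).flatten ++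
      invRev (reduceCyclically.conjugator x.toWord) := by
    rw [toWord_pow, reduceCyclically.reduce_flatten_replicate_succ isReduced_toWord]
  have h2 := reduceCyclically.conj_conjugator_reduceCyclically x.toWord
  unfold HeadIn FreeGroup.norm at *
  rw [h1]
  rw [← h2] at hx
  constructor
  · clear h1 h2
    generalize reduceCyclically.conjugator x.toWord = C at *
    generalize reduceCyclically x.toWord = R at *
    cases C <;> cases R <;> simp_all [List.replicate_succ]
  · intro _
    conv_lhs => rw [← h2]
    simp only [List.length_append, List.replicate_succ, List.flatten_cons]
    omega

lemma in_zpow {i : Fin 2} {x : F2} (hx : HeadIn i x) (hx' : LastIn i x) (j : ℤ) :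
    HeadIn i (x ^ j) ∧ LastIn i (x ^ j) ∧ (j ≠ 0 → x.norm ≤ (x ^ j).norm) := by
  have key : ∀ n : ℕ, HeadIn i (x ^ n) ∧ LastIn i (x ^ n) ∧ (n ≠ 0 → x.norm ≤ (x ^ n).norm) := by
    intro n
    refine ⟨(headIn_pow hx n).1, ?_, (headIn_pow hx n).2⟩
    rw [← headIn_inv, ← inv_pow]
    exact (headIn_pow (headIn_inv.2 hx') n).1
  obtain ⟨n, rfl | rfl⟩ := j.eq_nat_or_neg
  · simpa using key n
  · obtain ⟨h1, h2, h3⟩ := key n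
    rw [zpow_neg, zpow_natCast, headIn_inv, lastIn_inv, norm_inv_eq]
    exact ⟨h2, h1, fun h => h3 (by simpa using h)⟩

inductive GG (v : F2) : Fin 2 → F2 → Prop
  | base (n : ℤ) : GG v 1 (gb ^ n)
  | vs (j : ℤ) (x : F2) : j ≠ 0 → GG v 1 x → GG v 0 (v ^ j * x)
  | bs (n : ℤ) (x : F2) : n ≠ 0 → GG v 0 x → GG v 1 (gb ^ n * x)

lemma GG.mul_b {v : F2} {i : Fin 2} {x : F2} (h : GG v i x) (k : ℤ) : ∃ i, GG v i (gb ^ k * x) := by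
  cases h with
  | base n => rw [← zpow_add]; exact ⟨_, .base _⟩
  | vs j y hj hy =>
    by_cases hk : k = 0
    · subst hk; rw [zpow_zero, one_mul]; exact ⟨_, GG.vs j y hj hy⟩
    · exact ⟨_, .bs k _ hk (.vs j y hj hy)⟩
  | bs n y hn hy =>
    rw [← mul_assoc, ← zpow_add]
    by_cases hk : k + n = 0
    · rw [hk, zpow_zero, one_mul]; exact ⟨_, hy⟩
    · exact ⟨_, .bs _ _ hk hy⟩

lemma GG.mul_v {v : F2} {i : Fin 2} {x : F2} (h : GG v i x) (k : ℤ) : ∃ i, GG v i (v ^ k * x) := by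
  by_cases hk : k = 0
  · subst hk; rw [zpow_zero, one_mul]; exact ⟨_, h⟩
  cases h with
  | base n => exact ⟨_, .vs k _ hk (.base n)⟩
  | bs n y hn hy => exact ⟨_, .vs k _ hk (.bs n y hn hy)⟩
  | vs j y hj hy =>
    rw [← mul_assoc, ← zpow_add]
    by_cases hk : k + j = 0
    · rw [hk, zpow_zero, one_mul]; exact ⟨_, hy⟩
    · exact ⟨_, .vs _ _ hk hy⟩

lemma gb_in (n : ℤ) : HeadIn 1 (gb ^ n) ∧ LastIn 1 (gb ^ n) ∧ (n ≠ 0 → 1 ≤ (gb ^ n).norm) := by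
  have h1 : HeadIn 1 gb := by simp [HeadIn, gb]
  have h2 : LastIn 1 gb := by simp [LastIn, gb]
  simpa [gb] using in_zpow h1 h2 n

lemma headIn_append {i : Fin 2} {x y : F2} (h : (x * y).toWord = x.toWord ++ y.toWord)
    (hx : HeadIn i x) (hx1 : 1 ≤ x.norm) : HeadIn i (x * y) := by
  unfold HeadIn FreeGroup.norm at *
  rw [h]
  cases hX : x.toWord <;> simp_all

lemma GG.spec {v : F2} (h0 : HeadIn 0 v) (h1 : LastIn 0 v) (h2 : 2 ≤ v.norm) {i : Fin 2} {x : F2}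
    (h : GG v i x) : HeadIn i x ∧ (i = 0 → 2 ≤ x.norm) := by
  induction h with
  | base n => exact ⟨(gb_in n).1, by simp⟩
  | vs j x hj hx ih =>
    obtain ⟨a1, a2, a3⟩ := in_zpow h0 h1 j
    have hw := toWord_mul_of (by decide) a2 ih.1
    have := a3 hj
    refine ⟨headIn_append hw a1 (by omega), fun _ => ?_⟩
    have : (v ^ j * x).norm = (v ^ j).norm + x.norm := by simp [FreeGroup.norm, hw]
    omega
  | bs n x hn hx ih =>
    obtain ⟨a1, a2, a3⟩ := gb_in n
    exact ⟨headIn_append (toWord_mul_of (by decide) a2 ih.1) a1 (a3 hn), by simp⟩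

lemma not_gen {v : F2} (h0 : HeadIn 0 v) (h1 : LastIn 0 v) (h2 : 2 ≤ v.norm) :
    zpowers gb ⊔ zpowers v ≠ ⊤ := by
  intro h
  have key : ∀ x ∈ zpowers gb ⊔ zpowers v, (∀ y, (∃ i, GG v i y) → ∃ i, GG v i (x * y)) ∧
      (∀ y, (∃ i, GG v i y) → ∃ i, GG v i (x⁻¹ * y)) := by
    intro x hx
    rw [Subgroup.sup_eq_closure] at hx
    induction hx using Subgroup.closure_induction with
    | mem x hx =>
      rcases hx with hx | hx
      · obtain ⟨k, rfl⟩ := mem_zpowers_iff.1 hx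
        rw [← zpow_neg]
        exact ⟨fun y ⟨i, hy⟩ => hy.mul_b k, fun y ⟨i, hy⟩ => hy.mul_b _⟩
      · obtain ⟨k, rfl⟩ := mem_zpowers_iff.1 hx
        rw [← zpow_neg]
        exact ⟨fun y ⟨i, hy⟩ => hy.mul_v k, fun y ⟨i, hy⟩ => hy.mul_v _⟩
    | one => exact ⟨fun y hy => by rwa [one_mul], fun y hy => by rwa [inv_one, one_mul]⟩
    | mul x y _ _ hx hy =>
      refine ⟨fun z hz => ?_, fun z hz => ?_⟩
      · rw [mul_assoc]
        exact hx.1 _ (hy.1 _ hz)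
      · rw [mul_inv_rev, mul_assoc]
        exact hy.2 _ (hx.2 _ hz)
    | inv x _ hx => exact ⟨hx.2, by rw [inv_inv]; exact hx.1⟩
  obtain ⟨i, hi⟩ := (key ga (h ▸ mem_top _)).1 1 ⟨1, by simpa using GG.base (v := v) 0⟩
  rw [mul_one] at hi
  have hs := hi.spec h0 h1 h2
  simp only [HeadIn, ga, toWord_of, norm_of] at hs
  have : (0 : Fin 2) = i := by simpa using hs.1
  subst this
  simpa using hs.2

lemma mk_single (i : Fin 2) (s : Bool) : ∃ e : ℤ, (e = 1 ∨ e = -1) ∧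
    FreeGroup.mk [(i, s)] = (FreeGroup.of i) ^ e := by
  cases s
  · exact ⟨-1, by simp, by simp [of, inv_mk, invRev]⟩
  · exact ⟨1, by simp, by simp [of]⟩

lemma decomp_left (N : ℕ) : ∀ v : F2, v.norm ≤ N → ∃ (m : ℤ) (w : F2), v = gb ^ m * w ∧
    HeadIn 0 w ∧ w.norm ≤ v.norm ∧ (LastIn 0 v → LastIn 0 w) := by
  induction N with
  | zero =>
    intro v hv
    have : v = 1 := FreeGroup.norm_eq_zero.1 (by omega)
    subst this
    exact ⟨0, 1, by simp, by simp [HeadIn], le_rfl, id⟩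
  | succ N ih =>
    intro v hv
    by_cases hh : HeadIn 0 v
    · exact ⟨0, v, by simp, hh, le_rfl, id⟩
    cases hL : v.toWord with
    | nil => simp [HeadIn, hL] at hh
    | cons p L =>
      obtain ⟨i, s⟩ := p
      have hi : i = 1 := by
        simp only [HeadIn, hL] at hh
        have : i ≠ 0 := by simpa using hh
        omega
      subst hi
      obtain ⟨e, -, he⟩ := mk_single 1 s
      have hv2 : v = gb ^ e * FreeGroup.mk L := by
        rw [gb, ← he, mul_mk, List.singleton_append, ← hL, mk_toWord]
      have hLr : IsReduced L := by
        have : IsReduced v.toWord := isReduced_toWord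
        rw [hL] at this
        exact this.infix ⟨[(1, s)], [], by simp⟩
      have hW : (FreeGroup.mk L).toWord = L := by rw [toWord_mk, hLr.reduce_eq]
      have hn : (FreeGroup.mk L).norm + 1 = v.norm := by simp [FreeGroup.norm, hL, hW]
      obtain ⟨m, w, h1, h2, h3, h4⟩ := ih (FreeGroup.mk L) (by omega)
      refine ⟨e + m, w, by rw [zpow_add, mul_assoc, ← h1, hv2], h2, by omega, fun h => h4 ?_⟩
      unfold LastIn at *
      rw [hW]
      rw [hL] at h
      cases L <;> simp_all

lemma decomp (v : F2) : ∃ (m n : ℤ) (w : F2), v = gb ^ m * w * gb ^ n ∧ HeadIn 0 w ∧ LastIn 0 w := by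
  obtain ⟨n, w, h1, h2, -, -⟩ := decomp_left _ v⁻¹ le_rfl
  obtain ⟨m, w', h3, h4, -, h5⟩ := decomp_left _ w⁻¹ le_rfl
  refine ⟨m, -n, w', ?_, h4, h5 (lastIn_inv.2 h2)⟩
  rw [← h3, ← inv_inv v, h1]
  group

/-- The hom killing `b`. -/
def expA : F2 →* Multiplicative ℤ := FreeGroup.lift ![Multiplicative.ofAdd 1, 1]

@[simp] lemma expA_ga : expA ga = Multiplicative.ofAdd 1 := by simp [expA, ga]

@[simp] lemma expA_gb : expA gb = 1 := by simp [expA, gb]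

lemma class_b {v : F2} (h : zpowers gb ⊔ zpowers v = ⊤) :
    ∃ m n e : ℤ, (e = 1 ∨ e = -1) ∧ v = gb ^ m * ga ^ e * gb ^ n := by
  obtain ⟨m, n, w, hv, h1, h2⟩ := decomp v
  have hw : zpowers gb ⊔ zpowers w = ⊤ := by
    rw [eq_top_iff, ← h, sup_le_iff, zpowers_le, zpowers_le]
    have hb : gb ∈ zpowers gb ⊔ zpowers w := le_sup_left (a := zpowers gb) (mem_zpowers gb)
    have hw : w ∈ zpowers gb ⊔ zpowers w := le_sup_right (a := zpowers gb) (mem_zpowers w)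
    refine ⟨hb, ?_⟩
    rw [hv]
    exact mul_mem (mul_mem (zpow_mem hb _) hw) (zpow_mem hb _)
  have h3 : ¬ 2 ≤ w.norm := fun h3 => not_gen h1 h2 h3 hw
  cases hL : w.toWord with
  | nil =>
    rw [toWord_eq_nil_iff] at hL
    subst hL
    have : zpowers gb ⊔ zpowers (1 : F2) ≤ expA.ker := by
      rw [sup_le_iff, zpowers_le, zpowers_le]
      simp [MonoidHom.mem_ker]
    rw [hw] at this
    have h4 : ga ∈ expA.ker := this (mem_top _)
    rw [MonoidHom.mem_ker, expA_ga] at h4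
    exact absurd h4 (by decide)
  | cons p L =>
    have hL' : L = [] := by
      cases L with
      | nil => rfl
      | cons q L => simp [FreeGroup.norm, hL] at h3
    subst hL'
    obtain ⟨i, s⟩ := p
    have : i = 0 := by simpa [HeadIn, hL] using h1
    subst this
    obtain ⟨e, he, he'⟩ := mk_single 0 s
    refine ⟨m, n, e, he, ?_⟩
    rw [ga, ← he', ← hL, mk_toWord, hv]

def swp : F2 →* F2 := FreeGroup.lift ![gb, ga]

@[simp] lemma swp_ga : swp ga = gb := by simp [swp, ga]

@[simp] lemma swp_gb : swp gb = ga := by simp [swp, gb]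

lemma swp_swp (x : F2) : swp (swp x) = x := by
  have : swp.comp swp = MonoidHom.id F2 := by
    ext i
    fin_cases i
    · change swp (swp ga) = ga; simp
    · change swp (swp gb) = gb; simp
  exact DFunLike.congr_fun this x

lemma class_a {v : F2} (h : zpowers ga ⊔ zpowers v = ⊤) :
    ∃ m n e : ℤ, (e = 1 ∨ e = -1) ∧ v = ga ^ m * gb ^ e * ga ^ n := by
  have h' : zpowers gb ⊔ zpowers (swp v) = ⊤ := by
    have := congrArg (Subgroup.map swp) h
    rw [Subgroup.map_sup, MonoidHom.map_zpowers, MonoidHom.map_zpowers, swp_ga,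
      Subgroup.map_top_of_surjective _ (fun x => ⟨swp x, swp_swp x⟩)] at this
    exact this
  obtain ⟨m, n, e, he, hv⟩ := class_b h'
  refine ⟨m, n, e, he, ?_⟩
  rw [← swp_swp v, hv]
  simp

/-- Affine action on the rationals: `a` scales by `t`, `b` translates by one. -/
noncomputable def aff (t : ℚˣ) : F2 →* Equiv.Perm ℚ :=
  FreeGroup.lift ![Units.mulLeft t, Equiv.addRight 1]

lemma aff_a (t : ℚˣ) (n : ℤ) (x : ℚ) : aff t (ga ^ n) x = (t : ℚ) ^ n * x := by
  have h : ∀ (n : ℕ) (x : ℚ), aff t (ga ^ n) x = (t : ℚ) ^ n * x := by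
    intro n
    induction n with
    | zero => simp
    | succ n ih =>
      intro x
      rw [pow_succ, map_mul, Equiv.Perm.mul_apply, ih]
      simp [aff, ga, pow_succ, mul_assoc]
  obtain ⟨n, rfl | rfl⟩ := n.eq_nat_or_neg
  · simpa using h n x
  · rw [zpow_neg, map_inv, Equiv.Perm.inv_eq_iff_eq, zpow_natCast, h]
    have : (t : ℚ) ≠ 0 := t.ne_zero
    simp

lemma aff_b (t : ℚˣ) (n : ℤ) (x : ℚ) : aff t (gb ^ n) x = x + n := by
  have h : ∀ (n : ℕ) (x : ℚ), aff t (gb ^ n) x = x + n := by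
    intro n
    induction n with
    | zero => simp
    | succ n ih =>
      intro x
      rw [pow_succ, map_mul, Equiv.Perm.mul_apply, ih]
      simp [aff, gb]
      ring
  obtain ⟨n, rfl | rfl⟩ := n.eq_nat_or_neg
  · simpa using h n x
  · rw [zpow_neg, map_inv, Equiv.Perm.inv_eq_iff_eq, zpow_natCast, h]
    simp

lemma aff_a1 (t : ℚˣ) (x : ℚ) : aff t ga x = (t : ℚ) * x := by
  simpa using aff_a t 1 x

lemma Eadj.sup {S T : Subgroup F2} (h : Eadj S T) : S ⊔ T = ⊤ := by
  obtain ⟨u, v, rfl, rfl, hb⟩ := h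
  rw [eq_top_iff]
  intro x hx0
  clear hx0
  obtain ⟨z, rfl⟩ := hb.2 x
  have hu : u ∈ zpowers u ⊔ zpowers v := le_sup_left (a := zpowers u) (mem_zpowers u)
  have hv : v ∈ zpowers u ⊔ zpowers v := le_sup_right (a := zpowers u) (mem_zpowers v)
  induction z using FreeGroup.induction_on with
  | C1 => simp
  | of i => fin_cases i <;> simpa
  | inv_of i h => rw [map_inv]; exact inv_mem h
  | mul x y hx hy => rw [map_mul]; exact mul_mem hx hy

lemma eq_one_of (m n : ℤ) (h : zpowers gb ⊔ zpowers (ga * gb ^ m * ga * gb ^ n * ga⁻¹) = ⊤) :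
    n = 0 := by
  obtain ⟨p, q, e, he, h⟩ := class_b h
  have hE := congrArg expA h
  simp only [map_mul, map_zpow, map_inv, expA_ga, expA_gb] at hE
  have he1 : e = 1 := by
    have := congrArg Multiplicative.toAdd hE
    simp at this
    omega
  subst he1
  have h' : ga * gb ^ m * ga * gb ^ n = gb ^ p * ga * gb ^ q * ga := by
    rw [mul_inv_eq_iff_eq_mul] at h
    simpa using h
  have key : ∀ t : ℚˣ, (t : ℚ) * (t * n + m) = t * q + p := by
    intro t
    have := congrArg (fun f => aff t f 0) h'
    simpa [aff_a1, aff_b, map_mul, -map_zpow] using this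
  have k1 := key 1
  have k2 := key (-1)
  have k3 := key (Units.mk0 2 (by norm_num))
  push_cast [Units.val_mk0] at k1 k2 k3
  have : (n : ℚ) = 0 := by linarith
  exact_mod_cast this

lemma line_sub {k : ℤ} {T : Subgroup F2}
    (h : T ∈ line (zpowers gb) (zpowers ((ga * gb ^ k)⁻¹ * gb * (ga * gb ^ k)))) :
    ∃ m : ℤ, T = zpowers (gb ^ m * ga * gb ^ k) := by
  obtain ⟨h1, h2⟩ := h
  have s1 := Eadj.sup h1
  have s2 := Eadj.sup h2
  obtain ⟨_, v, -, rfl, -⟩ := h1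
  have : ∃ m n : ℤ, zpowers v = zpowers (gb ^ m * ga * gb ^ n) := by
    obtain ⟨m, n, e, rfl | rfl, hv⟩ := class_b s1
    · exact ⟨m, n, by simp [hv]⟩
    · refine ⟨-n, -m, ?_⟩
      rw [← zpowers_inv, hv]
      congr 1
      group
  obtain ⟨m, n, hv⟩ := this
  rw [hv] at s2 ⊢
  have s3 := congrArg (Subgroup.map (MulAut.conj (ga * gb ^ k)).toMonoidHom) s2
  rw [Subgroup.map_sup, MonoidHom.map_zpowers, MonoidHom.map_zpowers,
    Subgroup.map_top_of_surjective _ (MulAut.conj (ga * gb ^ k)).surjective] at s3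
  have e1 : (MulAut.conj (ga * gb ^ k)).toMonoidHom ((ga * gb ^ k)⁻¹ * gb * (ga * gb ^ k)) = gb := by
    change (ga * gb ^ k) * _ * (ga * gb ^ k)⁻¹ = _
    group
  have e2 : (MulAut.conj (ga * gb ^ k)).toMonoidHom (gb ^ m * ga * gb ^ n) =
      ga * gb ^ (k + m) * ga * gb ^ (n - k) * ga⁻¹ := by
    change (ga * gb ^ k) * _ * (ga * gb ^ k)⁻¹ = _
    group
  rw [e1, e2] at s3
  have := eq_one_of _ _ s3
  have : n = k := by omega
  exact ⟨m, by rw [this]⟩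

lemma isBasis_of {x y : F2} (p q : F2) (h1 : FreeGroup.lift ![p, q] x = ga)
    (h2 : FreeGroup.lift ![p, q] y = gb) (h3 : FreeGroup.lift ![x, y] p = ga)
    (h4 : FreeGroup.lift ![x, y] q = gb) : IsBasis x y := by
  have c1 : (FreeGroup.lift ![p, q]).comp (FreeGroup.lift ![x, y]) = MonoidHom.id F2 := by
    ext i
    fin_cases i
    · simpa [ga] using h1
    · simpa [gb] using h2
  have c2 : (FreeGroup.lift ![x, y]).comp (FreeGroup.lift ![p, q]) = MonoidHom.id F2 := by
    ext i
    fin_cases i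
    · simpa [ga] using h3
    · simpa [gb] using h4
  exact Function.bijective_iff_has_inverse.2 ⟨FreeGroup.lift ![p, q],
    fun z => DFunLike.congr_fun c1 z, fun z => DFunLike.congr_fun c2 z⟩

lemma lift_ga (x y : F2) : FreeGroup.lift ![x, y] ga = x := by simp [ga]

lemma lift_gb (x y : F2) : FreeGroup.lift ![x, y] gb = y := by simp [gb]

lemma mem_line (k m : ℤ) : zpowers (gb ^ m * ga * gb ^ k) ∈
    line (zpowers gb) (zpowers ((ga * gb ^ k)⁻¹ * gb * (ga * gb ^ k))) := by
  refine ⟨⟨_, _, rfl, rfl, ?_⟩, ⟨_, _, rfl, rfl, ?_⟩⟩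
  · apply isBasis_of (ga ^ (-m) * gb * ga ^ (-k)) ga <;>
    · simp only [map_mul, map_zpow, map_inv, lift_ga, lift_gb]
      try group
  · have hc : ∀ (c x : F2) (n : ℤ), (c⁻¹ * x * c) ^ n = c⁻¹ * x ^ n * c := fun c x n => by
      simpa using conj_zpow (i := n) (a := c⁻¹) (b := x)
    apply isBasis_of (gb * ga ^ (-m) * gb * ga ^ (-k) * gb⁻¹) (gb * ga * gb⁻¹) <;>
    · simp only [map_mul, map_zpow, map_inv, lift_ga, lift_gb, conj_zpow, hc]
      try group

lemma adj_of (k m : ℤ) (hk : k = 1 ∨ k = -1) :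
    Eadj (zpowers (gb ^ m * ga)) (zpowers (gb ^ m * ga * gb ^ k)) := by
  refine ⟨_, _, rfl, rfl, ?_⟩
  have hx : ∀ c : F2, (c ^ k) ^ k = c := by
    rcases hk with rfl | rfl <;> simp
  apply isBasis_of (((ga⁻¹ * gb) ^ k) ^ (-m) * ga) ((ga⁻¹ * gb) ^ k) <;>
  · simp only [map_mul, map_zpow, map_inv, lift_ga, lift_gb, hx, inv_mul_cancel_left]
    try group

end Helpers

/-- The line `ℓ(⟨b⟩, ⟨b^{a b^k}⟩)` is a (parallel) neighbor of
`ℓ = ℓ(⟨b⟩, ⟨b^a⟩)` iff `k ∈ {1, -1}`. -/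
theorem neighbor_lines_iff (k : ℤ) :
    (line (zpowers gb) (zpowers (ga⁻¹ * gb * ga)) ∩
        line (zpowers gb) (zpowers ((ga * gb ^ k)⁻¹ * gb * (ga * gb ^ k))) = ∅ ∧
      ∀ y₁ ∈ line (zpowers gb) (zpowers (ga⁻¹ * gb * ga)),
        ∃ y₂ ∈ line (zpowers gb) (zpowers ((ga * gb ^ k)⁻¹ * gb * (ga * gb ^ k))),
          Eadj y₁ y₂) ↔
    (k = 1 ∨ k = -1) := by
  have m0 : ∀ m : ℤ, zpowers (gb ^ m * ga) ∈ line (zpowers gb) (zpowers (ga⁻¹ * gb * ga)) := by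
    intro m
    simpa using mem_line 0 m
  have s0 : ∀ T ∈ line (zpowers gb) (zpowers (ga⁻¹ * gb * ga)),
      ∃ m : ℤ, T = zpowers (gb ^ m * ga) := by
    intro T hT
    simpa using line_sub (k := 0) (T := T) (by simpa using hT)
  constructor
  · rintro ⟨hd, hn⟩
    have hk : k ≠ 0 := by
      rintro rfl
      have h1 := m0 0
      have : zpowers (gb ^ (0 : ℤ) * ga) ∈ (∅ : Set (Subgroup F2)) := by
        rw [← hd]
        exact ⟨h1, by simpa using h1⟩
      exact this
    obtain ⟨T, hT, hE⟩ := hn _ (m0 0)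
    obtain ⟨n, rfl⟩ := line_sub hT
    have hs := hE.sup
    rw [zpow_zero, one_mul] at hs
    obtain ⟨p, q, e, he, h⟩ := class_a hs
    have key : ∀ t : ℚˣ, (t : ℚ) * k + n = t ^ p * e := by
      intro t
      have := congrArg (fun f => aff t f 0) h
      simpa [aff_a1, aff_a, aff_b, map_mul, -map_zpow] using this
    have k1 := key 1
    have k2 := key (-1)
    have h3 : ((-1 : ℚ)) ^ p = 1 ∨ (-1 : ℚ) ^ p = -1 := by
      rcases Int.even_or_odd p with hp | hp
      · exact Or.inl hp.neg_one_zpow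
      · exact Or.inr hp.neg_one_zpow
    push_cast at k1 k2
    rw [one_zpow] at k1
    rcases h3 with h3 | h3
    · rw [h3] at k2
      have : (k : ℚ) = 0 := by linarith
      exact absurd (by exact_mod_cast this) hk
    · rw [h3] at k2
      have : (k : ℚ) = e := by linarith
      have : k = e := by exact_mod_cast this
      rw [this]; exact he
  · intro hk
    constructor
    · rw [Set.eq_empty_iff_forall_notMem]
      rintro T ⟨h1, h2⟩
      obtain ⟨m, rfl⟩ := s0 _ h1
      obtain ⟨n, h⟩ := line_sub h2
      have hm : gb ^ m * ga ∈ zpowers (gb ^ n * ga * gb ^ k) := h ▸ mem_zpowers _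
      obtain ⟨j, hj⟩ := mem_zpowers_iff.1 hm
      have hj1 : j = 1 := by
        have := congrArg (fun z => Multiplicative.toAdd (expA z)) hj
        simpa using this
      subst hj1
      rw [zpow_one] at hj
      have key : ∀ t : ℚˣ, (t : ℚ) * k + n = m := by
        intro t
        have := congrArg (fun f => aff t f 0) hj
        simpa [aff_a1, aff_b, map_mul, -map_zpow] using this
      have k1 := key 1
      have k2 := key (-1)
      push_cast at k1 k2
      have : (k : ℚ) = 0 := by linarith
      have : k = 0 := by exact_mod_cast this
      omega
    · intro y hy
      obtain ⟨m, rfl⟩ := s0 _ hy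
      exact ⟨_, mem_line k m, adj_of k m hk⟩
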